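/- For d ≥ 2 and α > 0 with d − 2 + α > 0, all Taylor coefficients a_{2n+1} of the odd real-analytic function g(r) = σ_{d-1} ∫_0^π cos θ sin^{d-2}θ (r²+1−2r cos θ)^{−(d−2+α)/2} dθ at r = 0 are strictly positive; explicitly, a_{2n+1} = σ_d · [α(α+2)⋯(α+2n−2)/(2n)!!] · [(d+α−2)(d+α)⋯(d+α+2n−2)]/[d(d+2)⋯(d+2n)] > 0 for every n ≥ 0. -/

import Mathlib

open Real Finset

/-- binomial coefficients of `(1-x)^(-s)` -/
noncomputable def gbc (s : ℝ) : ℕ → ℝ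
  | 0 => 1
  | n + 1 => (s + n) / (n + 1) * gbc s n

lemma gbc_pos {s : ℝ} (hs : 0 < s) (n : ℕ) : 0 < gbc s n := by
  induction n with
  | zero => simp [gbc]
  | succ n ih => rw [gbc]; positivity

lemma gbc_eq (s : ℝ) (n : ℕ) : Ring.choose ((s : ℂ) + n - 1) n = (gbc s n : ℂ) := by
  rw [← Ring.multichoose_eq]
  have h : ∀ m : ℕ, (m.factorial : ℂ) * (gbc s m : ℂ) = (ascPochhammer ℂ m).eval (s : ℂ) := by
    intro m
    induction m with
    | zero => simp [gbc]
    | succ m ih =>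
      rw [ascPochhammer_succ_eval, ← ih, gbc, Nat.factorial_succ]
      have : (m : ℂ) + 1 ≠ 0 := by exact_mod_cast Nat.succ_ne_zero m
      push_cast
      field_simp
  have h2 := Ring.factorial_nsmul_multichoose_eq_ascPochhammer (s : ℂ) n
  rw [Polynomial.ascPochhammer_smeval_eq_eval, ← h n, nsmul_eq_mul] at h2
  exact mul_left_cancel₀ (by exact_mod_cast n.factorial_ne_zero) h2

lemma gbc_hasSum (s : ℝ) {w : ℂ} (hw : ‖w‖ < 1) :
    HasSum (fun n => (gbc s n : ℂ) * w ^ n) (1 / (1 - w) ^ (s : ℂ)) := by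
  have h := (Complex.one_div_one_sub_cpow_hasFPowerSeriesOnBall_zero (s : ℂ)).hasSum (y := w)
    (by simpa [enorm_eq_nnnorm] using! hw)
  simpa [FormalMultilinearSeries.ofScalars, gbc_eq] using h

lemma gbc_summable (s : ℝ) {r : ℝ} (hr : |r| < 1) :
    Summable (fun n => gbc s n * |r| ^ n) := by
  have h := (gbc_hasSum s (w := ((|r| : ℝ) : ℂ)) (by simpa using hr)).summable
  exact_mod_cast h

/-- Gegenbauer polynomials -/
noncomputable def ggp (s : ℝ) : ℕ → Polynomial ℝ
  | 0 => 1
  | 1 => Polynomial.C (2 * s) * Polynomial.X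
  | n + 2 => Polynomial.C (1 / ((n : ℝ) + 2)) *
      (Polynomial.C (2 * (n + 1 + s)) * Polynomial.X * ggp s (n + 1)
        - Polynomial.C (n + 2 * s) * ggp s n)

lemma ggp_rec (s : ℝ) (n : ℕ) :
    Polynomial.C ((n : ℝ) + 2) * ggp s (n + 2) =
      Polynomial.C (2 * (n + 1 + s)) * Polynomial.X * ggp s (n + 1)
        - Polynomial.C (n + 2 * s) * ggp s n := by
  rw [ggp, ← mul_assoc, ← Polynomial.C_mul]
  have : ((n : ℝ) + 2) * (1 / ((n : ℝ) + 2)) = 1 := by field_simp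
  rw [this]; simp

lemma ggp_der (s : ℝ) (n : ℕ) :
    (Polynomial.X * (ggp s (n + 1)).derivative - (ggp s n).derivative
      = Polynomial.C ((n : ℝ) + 1) * ggp s (n + 1)) ∧
    ((ggp s (n + 1)).derivative - Polynomial.X * (ggp s n).derivative
      = Polynomial.C ((n : ℝ) + 2 * s) * ggp s n) := by
  induction n with
  | zero =>
    constructor
    · simp [ggp]; ring
    · simp [ggp]
  | succ n ih =>
    obtain ⟨h1, h2⟩ := ih
    have hR := ggp_rec s n
    have hD := congrArg Polynomial.derivative hR
    have hne : Polynomial.C ((n : ℝ) + 2) ≠ 0 := by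
      rw [Ne, Polynomial.C_eq_zero]; positivity
    simp only [Polynomial.derivative_mul, Polynomial.derivative_C, Polynomial.derivative_X,
      Polynomial.derivative_sub, map_add, map_mul, Nat.cast_add, Nat.cast_one] at *
    have e2 : (ggp s (n + 1 + 1)).derivative - Polynomial.X * (ggp s (n+1)).derivative
      = (Polynomial.C (n : ℝ) + Polynomial.C 1 + Polynomial.C 2 * Polynomial.C s) * ggp s (n+1) := by
      apply mul_left_cancel₀ hne
      have c2 : (Polynomial.C 2 : Polynomial ℝ) = 2 := rfl
      simp only [Polynomial.C_1, c2] at *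
      linear_combination hD + (Polynomial.C (n : ℝ) + 2 * Polynomial.C s) * h1
    refine ⟨?_, e2⟩
    have c2 : (Polynomial.C 2 : Polynomial ℝ) = 2 := rfl
    simp only [Polynomial.C_1, c2] at *
    linear_combination Polynomial.X * e2 - hR + h1 * Polynomial.X - h2

lemma ggp_ode (s : ℝ) (n : ℕ) :
    (1 - Polynomial.X ^ 2) * (ggp s n).derivative.derivative
      - Polynomial.C (2 * s + 1) * Polynomial.X * (ggp s n).derivative
      + Polynomial.C (n * (n + 2 * s)) * ggp s n = 0 := by
  obtain ⟨h1, h2⟩ := ggp_der s n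
  have h3 := congrArg Polynomial.derivative h1
  have h4 := congrArg Polynomial.derivative h2
  simp only [Polynomial.derivative_mul, Polynomial.derivative_C, Polynomial.derivative_X,
      Polynomial.derivative_sub, map_add, map_mul, Polynomial.C_1, Polynomial.derivative_one] at *
  have c2 : (Polynomial.C 2 : Polynomial ℝ) = 2 := rfl
  simp only [c2] at *
  linear_combination -(Polynomial.C (n : ℝ)) * h2 - h3 + Polynomial.X * h4

/-- the functional -/
noncomputable def lam (k : ℕ) (P : Polynomial ℝ) : ℝ :=
  ∫ θ in (0:ℝ)..π, P.eval (Real.cos θ) * Real.sin θ ^ k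

lemma lam_int (k : ℕ) (P : Polynomial ℝ) :
    IntervalIntegrable (fun θ => P.eval (Real.cos θ) * Real.sin θ ^ k) MeasureTheory.volume 0 π := by
  apply Continuous.intervalIntegrable
  have := P.continuous
  fun_prop

lemma lam_add (k : ℕ) (P Q : Polynomial ℝ) : lam k (P + Q) = lam k P + lam k Q := by
  unfold lam
  rw [← intervalIntegral.integral_add (lam_int k P) (lam_int k Q)]
  simp [add_mul]

lemma lam_sub (k : ℕ) (P Q : Polynomial ℝ) : lam k (P - Q) = lam k P - lam k Q := by
  unfold lam
  rw [← intervalIntegral.integral_sub (lam_int k P) (lam_int k Q)]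
  simp [sub_mul]

lemma lam_C (k : ℕ) (c : ℝ) (P : Polynomial ℝ) : lam k (Polynomial.C c * P) = c * lam k P := by
  unfold lam
  rw [← intervalIntegral.integral_const_mul]
  simp [mul_assoc]

lemma lam_parts (k : ℕ) (Q : Polynomial ℝ) :
    lam k ((1 - Polynomial.X ^ 2) * Q.derivative) = (k + 1) * lam k (Polynomial.X * Q) := by
  have h : ∀ θ ∈ Set.uIcc (0:ℝ) π, HasDerivAt (fun θ => Q.eval (Real.cos θ) * Real.sin θ ^ (k + 1))
      ((Polynomial.C ((k:ℝ) + 1) * (Polynomial.X * Q) - (1 - Polynomial.X ^ 2) * Q.derivative).eval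
        (Real.cos θ) * Real.sin θ ^ k) θ := by
    intro θ _
    have h1 := (Q.hasDerivAt (Real.cos θ)).comp θ (Real.hasDerivAt_cos θ)
    have h2 := (Real.hasDerivAt_sin θ).pow (k + 1)
    refine (h1.mul h2).congr_deriv ?_
    have := Real.sin_sq_add_cos_sq θ
    simp
    linear_combination (-Polynomial.eval (cos θ) (Polynomial.derivative Q) * sin θ ^ k) * this
  have h3 := intervalIntegral.integral_eq_sub_of_hasDerivAt h (lam_int k _)
  change lam k _ = _ at h3
  rw [lam_sub, lam_C] at h3
  simp at h3
  linarith

lemma lam_rec (k : ℕ) (α : ℝ) (n : ℕ) :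
    ((n:ℝ) + 1) * (n + k + 3) * lam k (Polynomial.X * ggp ((k + α) / 2) (n + 2)) =
    (n + α - 1) * (n + α + k + 1) * lam k (Polynomial.X * ggp ((k + α) / 2) n) := by
  set s := ((k : ℝ) + α) / 2 with hs
  have hJ : ∀ m : ℕ, α * lam k (Polynomial.X ^ 2 * (ggp s m).derivative) =
      (m * (m + 2 * s) - (k + 1)) * lam k (Polynomial.X * ggp s m) := by
    intro m
    have h1 := lam_parts k (Polynomial.X * (ggp s m).derivative)
    have h2 := lam_parts k (ggp s m)
    have h3 : (1 - Polynomial.X ^ 2) * (Polynomial.X * (ggp s m).derivative).derivative =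
       (1 - Polynomial.X ^ 2) * (ggp s m).derivative +
       (Polynomial.C (2 * s + 1) * (Polynomial.X ^ 2 * (ggp s m).derivative)
         - Polynomial.C (m * (m + 2 * s)) * (Polynomial.X * ggp s m)) := by
      simp only [Polynomial.derivative_mul, Polynomial.derivative_X]
      linear_combination Polynomial.X * ggp_ode s m
    rw [h3, lam_add, lam_sub, lam_C, lam_C, h2, ← mul_assoc, ← sq] at h1
    have : 2 * s = k + α := by rw [hs]; ring
    rw [this] at h1 ⊢
    linarith
  have h0 := hJ n
  have h2 := hJ (n + 2)
  have hK : lam k (Polynomial.X ^ 2 * (ggp s (n + 2)).derivative) =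
      lam k (Polynomial.X ^ 2 * (ggp s n).derivative) + (n + 2 * s) * lam k (Polynomial.X * ggp s n)
       + (n + 2) * lam k (Polynomial.X * ggp s (n + 2)) := by
    rw [← lam_C, ← lam_C, ← lam_add, ← lam_add]
    congr 1
    have e1 := (ggp_der s (n + 1)).1
    have e2 := (ggp_der s n).2
    have : ((n + 1 : ℕ) : ℝ) + 1 = n + 2 := by push_cast; ring
    rw [this] at e1
    linear_combination Polynomial.X * e1 + Polynomial.X * e2
  have : 2 * s = k + α := by rw [hs]; ring
  push_cast at h2
  rw [hK] at h2
  rw [this] at *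
  linear_combination h0 - h2

lemma lam_zero (k : ℕ) (s : ℝ) : lam k (Polynomial.X * ggp s 0) = 0 := by
  have := lam_parts k 1
  simp [ggp] at this ⊢
  have h0 : lam k 0 = 0 := by simp [lam]
  rw [h0] at this
  have h : (k : ℝ) + 1 ≠ 0 := by positivity
  simpa [h] using this.symm

lemma lam_one (k : ℕ) (s : ℝ) : lam k (Polynomial.X * ggp s 1) = 2 * s / (k + 2) * lam k 1 := by
  have := lam_parts k Polynomial.X
  have e : (Polynomial.X * ggp s 1) = Polynomial.C (2 * s) * (Polynomial.X * Polynomial.X) := by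
    simp only [ggp]; ring
  rw [e, lam_C]
  rw [Polynomial.derivative_X, mul_one, lam_sub, pow_two] at this
  have h : (k : ℝ) + 2 ≠ 0 := by positivity
  field_simp
  linear_combination (-s) * this

lemma lam_even (k : ℕ) (α : ℝ) (m : ℕ) : lam k (Polynomial.X * ggp ((k + α) / 2) (2 * m)) = 0 := by
  induction m with
  | zero => exact lam_zero k _
  | succ m ih =>
    have := lam_rec k α (2 * m)
    rw [ih, mul_zero] at this
    have h : (((2 * m : ℕ):ℝ) + 1) * ((2 * m : ℕ) + k + 3) ≠ 0 := by positivity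
    exact (mul_eq_zero.1 this).resolve_left h

lemma lam_odd (k : ℕ) (α : ℝ) (n : ℕ) :
    lam k (Polynomial.X * ggp ((k + α) / 2) (2 * n + 1)) = lam k 1 *
     ((∏ j ∈ Finset.range n, (α + 2 * (j : ℝ))) / (∏ j ∈ Finset.range n, (2 * ((j : ℝ) + 1)))) *
        ((∏ j ∈ Finset.range (n + 1), ((k + 2 : ℝ) + α - 2 + 2 * (j : ℝ))) /
          (∏ j ∈ Finset.range (n + 1), ((k + 2 : ℝ) + 2 * (j : ℝ)))) := by
  induction n with
  | zero =>
    simp [lam_one]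
    ring
  | succ n ih =>
    have h := lam_rec k α (2 * n + 1)
    rw [ih] at h
    rw [prod_range_succ _ n, prod_range_succ _ n, prod_range_succ _ (n + 1),
      prod_range_succ _ (n + 1)]
    have p1 : (∏ j ∈ Finset.range n, (2 * ((j : ℝ) + 1))) ≠ 0 :=
      Finset.prod_ne_zero_iff.2 fun j _ => by positivity
    have p2 : (∏ j ∈ Finset.range (n + 1), ((k + 2 : ℝ) + 2 * (j : ℝ))) ≠ 0 :=
      Finset.prod_ne_zero_iff.2 fun j _ => by positivity
    generalize (∏ j ∈ Finset.range n, (2 * ((j : ℝ) + 1))) = q1 at *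
    generalize (∏ j ∈ Finset.range (n + 1), ((k + 2 : ℝ) + 2 * (j : ℝ))) = q2 at *
    generalize (∏ j ∈ Finset.range n, (α + 2 * (j : ℝ))) = q3 at *
    generalize (∏ j ∈ Finset.range (n + 1), ((k + 2 : ℝ) + α - 2 + 2 * (j : ℝ))) = q4 at *
    rw [show 2 * (n + 1) + 1 = 2 * n + 1 + 2 by ring]
    have h5 : (((2 * n + 1 : ℕ):ℝ) + 1) * ((2 * n + 1 : ℕ) + k + 3) ≠ 0 := by positivity
    apply mul_left_cancel₀ h5
    rw [h]
    push_cast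
    field_simp
    ring

lemma lam_val (k : ℕ) : lam k 1 = √π * Real.Gamma ((k + 1) / 2) / Real.Gamma ((k + 2) / 2) := by
  have : ∀ k : ℕ, (∫ θ in (0:ℝ)..π, Real.sin θ ^ k) =
      √π * Real.Gamma ((k + 1) / 2) / Real.Gamma ((k + 2) / 2) := by
    intro k
    induction k using Nat.twoStepInduction with
    | zero =>
      have := Real.Gamma_one_half_eq
      norm_num at this ⊢
      rw [this, Real.mul_self_sqrt Real.pi_pos.le]
    | one =>
      simp only [pow_one, integral_sin, Real.cos_zero, Real.cos_pi, Nat.cast_one]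
      rw [show ((1:ℝ) + 2) / 2 = 1 / 2 + 1 by norm_num, Real.Gamma_add_one (by norm_num),
        Real.Gamma_one_half_eq]
      norm_num
      have : √π ≠ 0 := by positivity
      field_simp
    | more k h _ =>
      rw [integral_sin_pow, h]
      push_cast
      rw [show ((k:ℝ) + 2 + 1) / 2 = (k + 1) / 2 + 1 by ring, Real.Gamma_add_one (by positivity),
        show ((k:ℝ) + 2 + 2) / 2 = (k + 2) / 2 + 1 by ring, Real.Gamma_add_one (by positivity)]
      have := (Real.Gamma_pos_of_pos (s := ((k:ℝ) + 2) / 2) (by positivity)).ne'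
      simp
      field_simp
  rw [← this]
  simp [lam]

lemma gps_ode (s : ℝ) (z : ℂ) :
    (1 - PowerSeries.C z * PowerSeries.X) *
      PowerSeries.derivative ℂ (PowerSeries.mk fun n => (gbc s n : ℂ) * z ^ n)
    = PowerSeries.C (s * z) * (PowerSeries.mk fun n => (gbc s n : ℂ) * z ^ n) := by
  ext n
  rw [sub_mul, one_mul, map_sub, mul_assoc, PowerSeries.coeff_C_mul, PowerSeries.coeff_C_mul,
    PowerSeries.coeff_derivative]
  have h : PowerSeries.coeff n (PowerSeries.X *
      PowerSeries.derivative ℂ (PowerSeries.mk fun n => (gbc s n : ℂ) * z ^ n)) =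
      n * ((gbc s n : ℂ) * z ^ n) := by
    cases n with
    | zero => simp
    | succ n => rw [PowerSeries.coeff_succ_X_mul, PowerSeries.coeff_derivative]; simp; ring
  rw [h]
  simp only [PowerSeries.coeff_mk, gbc]
  have : (n : ℂ) + 1 ≠ 0 := by exact_mod_cast Nat.succ_ne_zero n
  push_cast
  field_simp
  ring

lemma ggp_eq (s : ℝ) (z w : ℂ) (c : ℝ) (hzw : z * w = 1) (hc : z + w = 2 * c) (n : ℕ) :
    ∑ p ∈ HasAntidiagonal.antidiagonal n, ((gbc s p.1 : ℂ) * z ^ p.1) * ((gbc s p.2 : ℂ) * w ^ p.2)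
      = (((ggp s n).eval c : ℝ) : ℂ) := by
  set A := PowerSeries.mk fun n => (gbc s n : ℂ) * z ^ n with hA
  set B := PowerSeries.mk fun n => (gbc s n : ℂ) * w ^ n with hB
  have h1 := gps_ode s z
  have h2 := gps_ode s w
  rw [← hA] at h1
  rw [← hB] at h2
  have hG : ∀ n, ∑ p ∈ HasAntidiagonal.antidiagonal n,
      ((gbc s p.1 : ℂ) * z ^ p.1) * ((gbc s p.2 : ℂ) * w ^ p.2) = PowerSeries.coeff n (A * B) := by
    intro n
    rw [PowerSeries.coeff_mul]; simp [hA, hB]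
  rw [hG]
  have hode : PowerSeries.derivative ℂ (A * B)
      - PowerSeries.C (2 * c : ℂ) * (PowerSeries.X * PowerSeries.derivative ℂ (A * B))
      + PowerSeries.X * (PowerSeries.X * PowerSeries.derivative ℂ (A * B))
      = PowerSeries.C (2 * s * c : ℂ) * (A * B)
        - PowerSeries.C (2 * s : ℂ) * (PowerSeries.X * (A * B)) := by
    have hz : PowerSeries.C z * PowerSeries.C w = (1 : PowerSeries ℂ) := by
      rw [← map_mul, hzw, map_one]
    have hcc : PowerSeries.C z + PowerSeries.C w = (PowerSeries.C (2 * c : ℂ) : PowerSeries ℂ) := by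
      rw [← map_add, hc]
    have e3 : PowerSeries.C (2 * s * c : ℂ)
        = (PowerSeries.C (s : ℂ) * (PowerSeries.C z + PowerSeries.C w) : PowerSeries ℂ) := by
      rw [hcc, ← map_mul]; congr 1; ring
    have e4 : PowerSeries.C (2 * s : ℂ) = (2 * PowerSeries.C (s : ℂ) : PowerSeries ℂ) := by
      rw [map_mul]; rfl
    rw [e3, e4, ← hcc]
    rw [map_mul] at h1 h2
    have hd : PowerSeries.derivative ℂ (A * B) = A * PowerSeries.derivative ℂ B
       + B * PowerSeries.derivative ℂ A := by
      rw [Derivation.leibniz]; simp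
    rw [hd]
    generalize PowerSeries.derivative ℂ A = dA at *
    generalize PowerSeries.derivative ℂ B = dB at *
    generalize PowerSeries.C z = Z at *
    generalize PowerSeries.C w = W at *
    generalize PowerSeries.C (s : ℂ) = S at *
    generalize (PowerSeries.X : PowerSeries ℂ) = X at *
    linear_combination (1 - W * X) * B * h1 + (1 - Z * X) * A * h2
      + (-X^2 * (A * dB + B * dA) - 2 * S * X * A * B) * hz
  have hrec : ∀ n : ℕ, ((n : ℂ) + 2) * PowerSeries.coeff (n + 2) (A * B) =
      2 * (n + 1 + s) * c * PowerSeries.coeff (n + 1) (A * B)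
       - (n + 2 * s) * PowerSeries.coeff n (A * B) := by
    intro n
    have h := congrArg (PowerSeries.coeff (n + 1)) hode
    simp only [map_add, map_sub, PowerSeries.coeff_C_mul, PowerSeries.coeff_succ_X_mul,
      PowerSeries.coeff_derivative] at h
    have h3 : PowerSeries.coeff n (PowerSeries.X * PowerSeries.derivative ℂ (A * B)) =
      n * PowerSeries.coeff n (A * B) := by
      cases n with
      | zero => simp
      | succ n => rw [PowerSeries.coeff_succ_X_mul, PowerSeries.coeff_derivative]; push_cast; ring
    rw [h3] at h
    push_cast at h
    linear_combination h
  induction n using Nat.twoStepInduction with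
  | zero => simp [hA, hB, ggp, gbc]
  | one =>
    rw [← hG]
    simp [Finset.Nat.antidiagonal_succ, ggp, gbc]
    linear_combination s * hc
  | more n i0 i1 =>
    have h := hrec n
    rw [i0, i1] at h
    have heval := congrArg (Polynomial.eval c) (ggp_rec s n)
    simp only [Polynomial.eval_mul, Polynomial.eval_sub, Polynomial.eval_C, Polynomial.eval_X] at heval
    have hcast := congrArg (fun x : ℝ => (x : ℂ)) heval
    push_cast at hcast
    have hn : (n : ℂ) + 2 ≠ 0 := by exact_mod_cast Nat.succ_ne_zero (n + 1)
    apply mul_left_cancel₀ hn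
    rw [h, hcast]

lemma ggp_eq_cos (s θ : ℝ) (n : ℕ) :
    ∑ p ∈ HasAntidiagonal.antidiagonal n, ((gbc s p.1 : ℂ) * Complex.exp (θ * Complex.I) ^ p.1) *
      ((gbc s p.2 : ℂ) * Complex.exp (-(θ * Complex.I)) ^ p.2)
      = (((ggp s n).eval (Real.cos θ) : ℝ) : ℂ) := by
  apply ggp_eq
  · rw [← Complex.exp_add]; simp
  · rw [Complex.ofReal_cos, Complex.cos]; ring_nf

/-- summable majorant -/
noncomputable def gmaj (s r : ℝ) (n : ℕ) : ℝ :=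
  ∑ p ∈ HasAntidiagonal.antidiagonal n, (gbc s p.1 * |r| ^ p.1) * (gbc s p.2 * |r| ^ p.2)

lemma gmaj_summable (s : ℝ) {r : ℝ} (hr : |r| < 1) : Summable (gmaj s r) := by
  have h := gbc_summable s hr
  have hn : Summable fun n => ‖gbc s n * |r| ^ n‖ := h.norm
  exact (summable_norm_sum_mul_antidiagonal_of_summable_norm hn hn).of_norm

lemma ggp_bound {s : ℝ} (hs : 0 < s) (r θ : ℝ) (n : ℕ) :
    |(ggp s n).eval (Real.cos θ) * r ^ n| ≤ gmaj s r n := by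
  have h : |(ggp s n).eval (Real.cos θ) * r ^ n| =
    ‖(((ggp s n).eval (Real.cos θ) : ℝ) : ℂ) * (r : ℂ) ^ n‖ := by
    rw [← Complex.ofReal_pow, ← Complex.ofReal_mul, Complex.norm_real, Real.norm_eq_abs]
  rw [h, ← ggp_eq_cos, Finset.sum_mul, gmaj]
  refine (norm_sum_le _ _).trans (Finset.sum_le_sum fun p hp => ?_)
  rw [HasAntidiagonal.mem_antidiagonal] at hp
  have e1 : ‖Complex.exp (θ * Complex.I)‖ = 1 := Complex.norm_exp_ofReal_mul_I θ
  have e2 : ‖Complex.exp (-(θ * Complex.I))‖ = 1 := by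
    rw [Complex.exp_neg, norm_inv, e1, inv_one]
  simp only [norm_mul, norm_pow, e1, e2, Complex.norm_real, Real.norm_eq_abs,
    abs_of_pos (gbc_pos hs _), one_pow, mul_one]
  rw [← hp, pow_add]
  apply le_of_eq; ring

lemma ggp_hasSum {s : ℝ} {r : ℝ} (hr : |r| < 1) (θ : ℝ) :
    HasSum (fun n => (ggp s n).eval (Real.cos θ) * r ^ n)
      (1 / (r ^ 2 + 1 - 2 * r * Real.cos θ) ^ s) := by
  set z := Complex.exp (θ * Complex.I) with hz
  set w := Complex.exp (-(θ * Complex.I)) with hw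
  have e1 : ‖z‖ = 1 := Complex.norm_exp_ofReal_mul_I θ
  have e2 : ‖w‖ = 1 := by rw [hw, Complex.exp_neg, norm_inv, e1, inv_one]
  have hn1 : ‖(r : ℂ) * z‖ < 1 := by simpa [e1] using hr
  have hn2 : ‖(r : ℂ) * w‖ < 1 := by simpa [e2] using hr
  have h1 := gbc_hasSum s hn1
  have h2 := gbc_hasSum s hn2
  have n1 := h1.summable.norm
  have n2 := h2.summable.norm
  have hp := tsum_mul_tsum_eq_tsum_sum_antidiagonal_of_summable_norm n1 n2
  have hs := (summable_norm_sum_mul_antidiagonal_of_summable_norm n1 n2).of_norm.hasSum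
  rw [← hp, h1.tsum_eq, h2.tsum_eq] at hs
  have hterm : ∀ n, ∑ p ∈ HasAntidiagonal.antidiagonal n, ((gbc s p.1 : ℂ) * (r * z) ^ p.1) *
      ((gbc s p.2 : ℂ) * (r * w) ^ p.2) =
      (((ggp s n).eval (Real.cos θ) * r ^ n : ℝ) : ℂ) := by
    intro n
    push_cast
    rw [← ggp_eq_cos, Finset.sum_mul]
    refine Finset.sum_congr rfl fun p hp => ?_
    rw [HasAntidiagonal.mem_antidiagonal] at hp
    rw [← hp, pow_add, mul_pow, mul_pow]; ring
  simp only [hterm] at hs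
  have hval : (1 / (1 - (r : ℂ) * z) ^ (s : ℂ)) * (1 / (1 - (r : ℂ) * w) ^ (s : ℂ)) =
     ((1 / (r ^ 2 + 1 - 2 * r * Real.cos θ) ^ s : ℝ) : ℂ) := by
    set u := 1 - (r : ℂ) * z with hu
    have hre : 0 < u.re := by
      have := (Complex.re_le_norm ((r : ℂ) * z)).trans_lt hn1
      rw [hu, Complex.sub_re, Complex.one_re]; linarith
    have hu0 : u ≠ 0 := by rintro h; rw [h] at hre; simp at hre
    have harg : u.arg ≠ π := by
      have := Complex.abs_arg_lt_pi_div_two_iff.2 (Or.inl hre)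
      intro h
      rw [h, abs_of_pos Real.pi_pos] at this
      linarith [Real.pi_pos]
    have hconj : 1 - (r : ℂ) * w = (starRingEnd ℂ) u := by
      rw [hu, hw, hz]
      simp [← Complex.exp_conj]
    have hns : r ^ 2 + 1 - 2 * r * Real.cos θ = ‖u‖ ^ 2 := by
      rw [← Complex.normSq_eq_norm_sq, hu, hz, Complex.exp_mul_I, Complex.normSq_apply]
      simp [Complex.cos_ofReal_re, Complex.sin_ofReal_re, Complex.cos_ofReal_im, Complex.sin_ofReal_im]
      linear_combination (-r^2) * Real.sin_sq_add_cos_sq θ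
    rw [hconj, Complex.conj_cpow _ _ harg, Complex.conj_ofReal, hns, div_mul_div_comm, one_mul,
      Complex.mul_conj, Complex.normSq_eq_norm_sq, Complex.norm_cpow_of_ne_zero hu0]
    simp
    rw [← Complex.ofReal_pow, ← Real.rpow_natCast, ← Real.rpow_natCast, ← Real.rpow_mul (norm_nonneg _),
      ← Real.rpow_mul (norm_nonneg _), mul_comm]
  rw [hval] at hs
  exact Complex.hasSum_ofReal.1 hs

lemma lam_hasSum (k : ℕ) {s : ℝ} (hs : 0 < s) {r : ℝ} (hr : |r| < 1) :
    HasSum (fun n => lam k (Polynomial.X * ggp s n) * r ^ n)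
      (∫ θ in (0:ℝ)..π, Real.cos θ * Real.sin θ ^ k / (r ^ 2 + 1 - 2 * r * Real.cos θ) ^ s) := by
  have h := intervalIntegral.hasSum_integral_of_dominated_convergence
    (μ := MeasureTheory.volume) (a := 0) (b := π)
    (F := fun n θ => (Polynomial.X * ggp s n).eval (Real.cos θ) * Real.sin θ ^ k * r ^ n)
    (f := fun θ => Real.cos θ * Real.sin θ ^ k / (r ^ 2 + 1 - 2 * r * Real.cos θ) ^ s)
    (fun n _ => gmaj s r n) ?_ ?_ ?_ ?_ ?_
  · simpa only [lam, intervalIntegral.integral_mul_const] using h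
  · intro n
    apply Continuous.aestronglyMeasurable
    have := (Polynomial.X * ggp s n).continuous
    fun_prop
  · intro n
    filter_upwards with θ _
    have h1 := ggp_bound hs r θ n
    have h2 := Real.abs_cos_le_one θ
    have h3 : |Real.sin θ| ^ k ≤ 1 := pow_le_one₀ (abs_nonneg _) (Real.abs_sin_le_one θ)
    have e : (Polynomial.X * ggp s n).eval (Real.cos θ) * Real.sin θ ^ k * r ^ n =
      (Real.cos θ * Real.sin θ ^ k) * ((ggp s n).eval (Real.cos θ) * r ^ n) := by
      simp; ring
    rw [e, Real.norm_eq_abs, abs_mul, abs_mul (Real.cos θ), abs_pow]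
    have h4 : |Real.cos θ| * |Real.sin θ| ^ k ≤ 1 := mul_le_one₀ h2 (by positivity) h3
    calc _ ≤ 1 * |(ggp s n).eval (Real.cos θ) * r ^ n| :=
          mul_le_mul_of_nonneg_right h4 (abs_nonneg _)
      _ ≤ _ := by rw [one_mul]; exact h1
  · filter_upwards with θ _ using gmaj_summable s hr
  · simp
  · filter_upwards with θ _
    have h1 := (ggp_hasSum (s := s) hr θ).mul_left (Real.cos θ * Real.sin θ ^ k)
    rw [mul_one_div] at h1
    convert! h1 using 2 with n
    simp; ring

/-- All Taylor coefficients of the kernel g at 0 are strictly positive, with explicit formula. -/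
theorem stmt_6 (d : ℕ) (hd : 2 ≤ d) (α : ℝ) (hα : 0 < α) (hdα : (d : ℝ) - 2 + α > 0)
    (a : ℕ → ℝ)
    (ha : ∀ n : ℕ, a n =
      (2 * Real.pi ^ ((d : ℝ) / 2) / Real.Gamma ((d : ℝ) / 2)) *
        ((∏ k ∈ Finset.range n, (α + 2 * (k : ℝ))) / (∏ k ∈ Finset.range n, (2 * ((k : ℝ) + 1)))) *
        ((∏ k ∈ Finset.range (n + 1), ((d : ℝ) + α - 2 + 2 * (k : ℝ))) /
          (∏ k ∈ Finset.range (n + 1), ((d : ℝ) + 2 * (k : ℝ))))) :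
    (∀ n : ℕ, 0 < a n) ∧
    ∀ r ∈ Set.Ioo (-1 : ℝ) 1,
      (2 * Real.pi ^ (((d : ℝ) - 1) / 2) / Real.Gamma (((d : ℝ) - 1) / 2)) *
        ∫ θ in (0:ℝ)..π,
          Real.cos θ * Real.sin θ ^ (d - 2) /
            (r ^ 2 + 1 - 2 * r * Real.cos θ) ^ (((d : ℝ) - 2 + α) / 2)
      = ∑' n : ℕ, a n * r ^ (2 * n + 1) := by
  obtain ⟨k, rfl⟩ := Nat.exists_eq_add_of_le' hd
  constructor
  · intro n
    rw [ha]
    have h1 : ∀ j : ℕ, 0 < ((k + 2 : ℕ) : ℝ) + α - 2 + 2 * (j : ℝ) := by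
      intro j
      have : (0:ℝ) ≤ j := j.cast_nonneg
      linarith
    have hG := Real.Gamma_pos_of_pos (s := ((k + 2 : ℕ) : ℝ) / 2) (by positivity)
    have p1 : 0 < ∏ k ∈ Finset.range n, (α + 2 * (k : ℝ)) :=
      Finset.prod_pos fun j _ => by positivity
    have p2 : 0 < ∏ k ∈ Finset.range n, (2 * ((k : ℝ) + 1)) :=
      Finset.prod_pos fun j _ => by positivity
    have p3 : 0 < ∏ j ∈ Finset.range (n + 1), (((k + 2 : ℕ) : ℝ) + α - 2 + 2 * (j : ℝ)) :=
      Finset.prod_pos fun j _ => h1 j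
    have p4 : 0 < ∏ j ∈ Finset.range (n + 1), (((k + 2 : ℕ) : ℝ) + 2 * (j : ℝ)) :=
      Finset.prod_pos fun j _ => by positivity
    have := Real.pi_pos
    positivity
  · intro r hr
    have habs : |r| < 1 := abs_lt.2 hr
    rw [show k + 2 - 2 = k by omega]
    push_cast at *
    rw [show (k : ℝ) + 2 - 2 + α = k + α by ring, show (k : ℝ) + 2 - 1 = k + 1 by ring] at *
    have h := lam_hasSum k (s := (k + α) / 2) (by positivity) habs
    have hinj : Function.Injective (fun n : ℕ => 2 * n + 1) := fun a b h => by
      simp at h; exact h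
    have h2 := (hinj.hasSum_iff (f := fun n => lam k (Polynomial.X * ggp ((k + α) / 2) n) * r ^ n)
      (a := ∫ θ in (0:ℝ)..π, Real.cos θ * Real.sin θ ^ k /
        (r ^ 2 + 1 - 2 * r * Real.cos θ) ^ ((k + α) / 2)) ?_).2 h
    · have h3 := h2.mul_left (2 * Real.pi ^ (((k : ℝ) + 1) / 2) / Real.Gamma (((k : ℝ) + 1) / 2))
      rw [← h3.tsum_eq]
      congr 1
      ext n
      have hpi : π ^ (((k : ℝ) + 2) / 2) = π ^ (((k : ℝ) + 1) / 2) * √π := by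
        rw [Real.sqrt_eq_rpow, ← Real.rpow_add Real.pi_pos]; congr 1; ring
      have hG := (Real.Gamma_pos_of_pos (s := ((k : ℝ) + 1) / 2) (by positivity)).ne'
      have hc : 2 * Real.pi ^ (((k : ℝ) + 1) / 2) / Real.Gamma (((k : ℝ) + 1) / 2) * lam k 1 =
          2 * Real.pi ^ (((k : ℝ) + 2) / 2) / Real.Gamma (((k : ℝ) + 2) / 2) := by
        rw [lam_val, hpi]
        field_simp
      rw [ha, ← hc]
      simp only [Function.comp]
      rw [lam_odd]
      ring
    · intro n hn
      rcases Nat.even_or_odd' n with ⟨m, rfl | rfl⟩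
      · simp only [lam_even, zero_mul]
      · exact absurd ⟨m, rfl⟩ hn
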